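/- arXiv:1006.2145 — 2 statements merged into one kernel-verified Lean document; each statement's English description precedes it below -/
import Mathlib

section
/- Define T_{α,β}: ((x₁,x₂),(y₁,y₂)) ↦ ((ũ₁,ũ₂),(ṽ₁,ṽ₂)) with ũ₁ = (αx₁ − y₁x₁ − y₂)y₂/D, ũ₂ = x₂ − (β + (y₁−1)y₁)/y₂, ṽ₂ = x₁ − (αx₁ − y₁x₁ − y₂)y₂/D, ṽ₁ = (β(αx₁ − y₂) + (y₁x₁ − x₁ + y₂)(αy₁ + x₂y₂) + x₁x₂(x₁(y₁² − y₁ + β) + y₁y₂))/D, where D = βx₁ + (y₁−1)y₁x₁ + (α + y₁ − 1)y₂. Then L₂(ũ₁,ũ₂;α,ζ)L₁(ṽ₁,ṽ₂;β,ζ) = L₁(y₁,y₂;β,ζ)L₂(x₁,x₂;α,ζ) for all ζ, where L₁(x₁,x₂;α,ζ) = [[x₁−ζ, x₂],[−(α+(x₁−1)x₁)/x₂, 1−x₁−ζ]] and L₂(x₁,x₂;α,ζ) = [[x₁x₂+α−ζ, x₁],[x₂, 1]]. -/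
open Matrix

/-- The Lax matrix `L₁(x₁,x₂;α,ζ)`. -/
noncomputable def L1mat (x₁ x₂ a ζ : ℂ) : Matrix (Fin 2) (Fin 2) ℂ :=
  !![x₁ - ζ, x₂; -(a + (x₁ - 1) * x₁) / x₂, 1 - x₁ - ζ]

/-- The Lax matrix `L₂(x₁,x₂;α,ζ)`. -/
def L2mat (x₁ x₂ a ζ : ℂ) : Matrix (Fin 2) (Fin 2) ℂ :=
  !![x₁ * x₂ + a - ζ, x₁; x₂, 1]

theorem stmt17 (a b x₁ x₂ y₁ y₂ : ℂ) (hy₂ : y₂ ≠ 0)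
    (hD : b * x₁ + (y₁ - 1) * y₁ * x₁ + (a + y₁ - 1) * y₂ ≠ 0) :
    let D := b * x₁ + (y₁ - 1) * y₁ * x₁ + (a + y₁ - 1) * y₂
    let u₁ := (a * x₁ - y₁ * x₁ - y₂) * y₂ / D
    let u₂ := x₂ - (b + (y₁ - 1) * y₁) / y₂
    let v₁ := (b * (a * x₁ - y₂) + (y₁ * x₁ - x₁ + y₂) * (a * y₁ + x₂ * y₂) +
      x₁ * x₂ * (x₁ * (y₁ ^ 2 - y₁ + b) + y₁ * y₂)) / D
    let v₂ := x₁ - (a * x₁ - y₁ * x₁ - y₂) * y₂ / D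
    v₂ ≠ 0 →
      ∀ ζ : ℂ, L2mat u₁ u₂ a ζ * L1mat v₁ v₂ b ζ =
        L1mat y₁ y₂ b ζ * L2mat x₁ x₂ a ζ := by
  intro D u₁ u₂ v₁ v₂ hv ζ
  obtain ⟨k, hk⟩ : ∃ k, k = (b + (y₁ - 1) * y₁) / y₂ := ⟨_, rfl⟩
  have hkY : k * y₂ = b + (y₁ - 1) * y₁ := by rw [hk]; field_simp
  have hb : b = k * y₂ - (y₁ - 1) * y₁ := by rw [hkY]; ring
  have hu₂ : u₂ = x₂ - k := by rw [hk]
  have hDE : D = y₂ * (k * x₁ + a + y₁ - 1) := by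
    simp only [D]; rw [hb]; ring
  have hD' : D ≠ 0 := hD
  have hu₁D : u₁ * D = (a * x₁ - y₁ * x₁ - y₂) * y₂ := div_mul_cancel₀ _ hD'
  have hu₁ : u₁ * (k * x₁ + a + y₁ - 1) = a * x₁ - y₁ * x₁ - y₂ := by
    apply mul_right_cancel₀ hy₂
    rw [← hu₁D, hDE]; ring
  have hv₂ : v₂ = x₁ - u₁ := rfl
  have hv₁D : v₁ * D = b * (a * x₁ - y₂) + (y₁ * x₁ - x₁ + y₂) * (a * y₁ + x₂ * y₂) +
      x₁ * x₂ * (x₁ * (y₁ ^ 2 - y₁ + b) + y₁ * y₂) := div_mul_cancel₀ _ hD'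
  have hv₁ : v₁ = y₁ + x₁ * x₂ - u₁ * (x₂ - k) := by
    apply mul_right_cancel₀ hD'
    have h : (y₁ + x₁ * x₂ - u₁ * (x₂ - k)) * D
        = (y₁ + x₁ * x₂) * D - (u₁ * D) * (x₂ - k) := by ring
    rw [h, hv₁D, hu₁D, hDE, hb]; ring
  clear_value D u₁ u₂ v₁ v₂
  have hy : y₂ = a * x₁ - y₁ * x₁ - u₁ * (k * x₁ + a + y₁ - 1) := by rw [hu₁]; ring
  have hq : -(b + (v₁ - 1) * v₁) / v₂ =
      -(u₂ * v₁ + k * (x₁ * x₂ + a) - (1 - y₁) * x₂) := by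
    rw [div_eq_iff hv, hb, hv₂, hu₂, hv₁, hy]; ring
  have hk' : -(b + (y₁ - 1) * y₁) / y₂ = -k := by rw [hk]; ring
  unfold L1mat L2mat
  rw [hq, hk', Matrix.mul_fin_two, Matrix.mul_fin_two, hv₂, hu₂, hv₁, hy]
  congr 1
  ext i j
  fin_cases i <;> fin_cases j <;> simp <;> ring
end

section
/- The maps S_{α,β}, R_{α,β}, T_{α,β} (the three maps admitting the strong Lax triple (L₁, L₂, L₁)) satisfy the entwining Yang–Baxter equation T²³_{β,γ} ∘ R¹³_{α,γ} ∘ S¹²_{α,β} = S¹²_{α,β} ∘ R¹³_{α,γ} ∘ T²³_{β,γ} as rational maps on (ℂ²)³. -/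
noncomputable section

/-- The map `S_{α,β}` with strong Lax pair `(L₁,L₂)`. -/
def smap (a b : ℂ) (p : (ℂ × ℂ) × (ℂ × ℂ)) : (ℂ × ℂ) × (ℂ × ℂ) :=
  let x₁ := p.1.1; let x₂ := p.1.2; let y₁ := p.2.1; let y₂ := p.2.2
  let d := x₂ * y₂ - x₁ - b + 1
  ((y₂ * y₁ - x₁ * y₁ / x₂ + (a + b * (x₂ * y₂ - x₁)) * (x₂ + y₁) / (x₂ * d),
    -(a * (x₂ + y₁) ^ 2 + (b * x₂ + y₁ * y₂ * x₂ - x₁ * y₁ + y₁) *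
        (x₂ * (b + y₁ * y₂ - 1) - x₁ * y₁)) / (x₂ * d)),
   (x₂ + y₁,
    x₁ / x₂ - (a + b * (x₂ * y₂ - x₁)) / (x₂ * d)))

/-- Domain of definition of `S_{α,β}`. -/
def sDom (b : ℂ) (p : (ℂ × ℂ) × (ℂ × ℂ)) : Prop :=
  p.1.2 ≠ 0 ∧ p.1.2 * p.2.2 - p.1.1 - b + 1 ≠ 0

/-- The quadrirational Yang–Baxter map `R_{α,β}` with Lax pair `(L₁,L₁)`. -/
def rmap (a b : ℂ) (p : (ℂ × ℂ) × (ℂ × ℂ)) : (ℂ × ℂ) × (ℂ × ℂ) :=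
  let x₁ := p.1.1; let x₂ := p.1.2; let y₁ := p.2.1; let y₂ := p.2.2
  let N := a * y₂ ^ 2 + b * x₂ ^ 2 + (a + b - 1) * y₂ * x₂ +
    (x₂ * y₁ - x₁ * y₂) * (x₂ * y₁ - x₁ * y₂ + y₂ - x₂)
  ((y₁ + x₂ * y₂ * (a - b) * (x₁ + y₁ - 1) / N,
    y₂ / N * (a * (x₂ + y₂) ^ 2 +
      (x₂ * (y₁ - 1) - x₁ * y₂) * (x₂ * y₁ - x₁ * y₂ + y₂))),
   (x₁ - x₂ * y₂ * (a - b) * (x₁ + y₁ - 1) / N,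
    x₂ / N * (b * (x₂ + y₂) ^ 2 +
      (x₂ * (y₁ - 1) - x₁ * y₂) * (x₂ * y₁ - x₁ * y₂ + y₂))))

/-- Domain of definition of `R_{α,β}`. -/
def rDom (a b : ℂ) (p : (ℂ × ℂ) × (ℂ × ℂ)) : Prop :=
  a * p.2.2 ^ 2 + b * p.1.2 ^ 2 + (a + b - 1) * p.2.2 * p.1.2 +
    (p.1.2 * p.2.1 - p.1.1 * p.2.2) *
      (p.1.2 * p.2.1 - p.1.1 * p.2.2 + p.2.2 - p.1.2) ≠ 0

/-- The map `T_{α,β}` with strong Lax pair `(L₂,L₁)`. -/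
def tmap (a b : ℂ) (p : (ℂ × ℂ) × (ℂ × ℂ)) : (ℂ × ℂ) × (ℂ × ℂ) :=
  let x₁ := p.1.1; let x₂ := p.1.2; let y₁ := p.2.1; let y₂ := p.2.2
  let D := b * x₁ + (y₁ - 1) * y₁ * x₁ + (a + y₁ - 1) * y₂
  (((a * x₁ - y₁ * x₁ - y₂) * y₂ / D,
    x₂ - (b + (y₁ - 1) * y₁) / y₂),
   ((b * (a * x₁ - y₂) + (y₁ * x₁ - x₁ + y₂) * (a * y₁ + x₂ * y₂) +
      x₁ * x₂ * (x₁ * (y₁ ^ 2 - y₁ + b) + y₁ * y₂)) / D,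
    x₁ - (a * x₁ - y₁ * x₁ - y₂) * y₂ / D))

/-- Domain of definition of `T_{α,β}`. -/
def tDom (a b : ℂ) (p : (ℂ × ℂ) × (ℂ × ℂ)) : Prop :=
  p.2.2 ≠ 0 ∧ b * p.1.1 + (p.2.1 - 1) * p.2.1 * p.1.1 + (a + p.2.1 - 1) * p.2.2 ≠ 0

/-- Action on the factors 1,2 of `(ℂ²)³`. -/
def act12 (f : (ℂ × ℂ) × (ℂ × ℂ) → (ℂ × ℂ) × (ℂ × ℂ)) :
    (ℂ × ℂ) × (ℂ × ℂ) × (ℂ × ℂ) → (ℂ × ℂ) × (ℂ × ℂ) × (ℂ × ℂ) :=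
  fun p => ((f (p.1, p.2.1)).1, (f (p.1, p.2.1)).2, p.2.2)

/-- Action on the factors 1,3 of `(ℂ²)³`. -/
def act13 (f : (ℂ × ℂ) × (ℂ × ℂ) → (ℂ × ℂ) × (ℂ × ℂ)) :
    (ℂ × ℂ) × (ℂ × ℂ) × (ℂ × ℂ) → (ℂ × ℂ) × (ℂ × ℂ) × (ℂ × ℂ) :=
  fun p => ((f (p.1, p.2.2)).1, p.2.1, (f (p.1, p.2.2)).2)

/-- Action on the factors 2,3 of `(ℂ²)³`. -/
def act23 (f : (ℂ × ℂ) × (ℂ × ℂ) → (ℂ × ℂ) × (ℂ × ℂ)) :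
    (ℂ × ℂ) × (ℂ × ℂ) × (ℂ × ℂ) → (ℂ × ℂ) × (ℂ × ℂ) × (ℂ × ℂ) :=
  fun p => (p.1, f p.2)

/-- A point of the configuration space together with the three parameters. -/
structure Pt where
  a : ℂ
  b : ℂ
  c : ℂ
  x1 : ℂ
  x2 : ℂ
  y1 : ℂ
  y2 : ℂ
  z1 : ℂ
  z2 : ℂ

def Pt.Z (s : Pt) : ℂ :=
  s.c + s.z1^2 - s.z1

def Pt.X (s : Pt) : ℂ :=
  s.a + s.x1^2 - s.x1

def Pt.q (s : Pt) : ℂ :=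
  s.x2 * s.y2 - s.x1

def Pt.d (s : Pt) : ℂ :=
  s.q - s.b + 1

def Pt.e (s : Pt) : ℂ :=
  s.x2 * s.d

def Pt.Pq (s : Pt) : ℂ :=
  s.q^2 + s.q + s.a

def Pt.V2n (s : Pt) : ℂ :=
  s.x1 * s.d - s.a - s.b * s.q

def Pt.U1 (s : Pt) : ℂ :=
  s.y1 * s.Pq + (s.a + s.b * s.q) * s.x2

def Pt.G (s : Pt) : ℂ :=
  s.a * (s.x2 + s.y1)^2 + (s.b * s.x2 + s.y1 * s.q + s.y1) * (s.x2 * (s.b - 1) + s.q * s.y1)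

def Pt.Nr (s : Pt) : ℂ :=
  s.z2 * ((s.a + s.c + s.z1 - 1) * s.e + (1 - 2 * s.z1) * s.U1) - s.G * s.Z - s.Pq * s.z2^2

def Pt.al1 (s : Pt) : ℂ :=
  s.U1 + (s.z1 - 1) * s.e

def Pt.al2 (s : Pt) : ℂ :=
  s.z2 * s.e - s.G

def Pt.al3 (s : Pt) : ℂ :=
  s.Z * s.e - s.z2 * s.Pq

def Pt.D (s : Pt) : ℂ :=
  s.y1 * s.Z + (s.b + s.z1 - 1) * s.z2

def Pt.W2 (s : Pt) : ℂ :=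
  s.y1^2 * s.Z + s.y1 * (2 * s.z1 - 1) * s.z2 + s.z2^2

def Pt.W1 (s : Pt) : ℂ :=
  s.c * (s.b * s.y1 - s.z2) + (s.z1 * s.y1 - s.y1 + s.z2) * (s.b * s.z1 + s.y2 * s.z2) + s.y1 * s.y2 * (s.y1 * s.Z + s.z1 * s.z2)

def Pt.t1 (s : Pt) : ℂ :=
  s.b * s.y1 - s.z1 * s.y1 - s.z2

def Pt.t (s : Pt) : ℂ :=
  s.y2 * s.z2 - s.Z

def Pt.W3 (s : Pt) : ℂ :=
    -s.b^2*s.c - s.b^2*s.z1^2 + s.b^2*s.z1 - 2*s.b*s.c*s.y1*s.y2 + s.b*s.c - 2*s.b*s.y1*s.y2*s.z1^2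
    + 2*s.b*s.y1*s.y2*s.z1 - 2*s.b*s.y2*s.z1*s.z2 + s.b*s.y2*s.z2 + s.b*s.z1^2 - s.b*s.z1 - s.c^2 -
    s.c*s.y1^2*s.y2^2 + s.c*s.y1*s.y2 + 2*s.c*s.y2*s.z2 - s.c*s.z1^2 + s.c*s.z1 -
    s.y1^2*s.y2^2*s.z1^2 + s.y1^2*s.y2^2*s.z1 - 2*s.y1*s.y2^2*s.z1*s.z2 + s.y1*s.y2^2*s.z2 +
    s.y1*s.y2*s.z1^2 - s.y1*s.y2*s.z1 - s.y2^2*s.z2^2 + s.y2*s.z1*s.z2 - s.y2*s.z2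

def Pt.Nq (s : Pt) : ℂ :=
  s.x2 * ((s.c + s.a + s.x1 - 1) * s.D + (1 - 2 * s.x1) * s.W1) + s.W2 * s.X - s.W3 * s.x2^2

def Pt.be1 (s : Pt) : ℂ :=
  s.W1 + (s.x1 - 1) * s.D

def Pt.be2 (s : Pt) : ℂ :=
  s.x2 * s.D + s.W2

def Pt.ka (s : Pt) : ℂ :=
  s.X * s.D - s.x2 * s.W3

def Pt.p2 (s : Pt) : ℂ :=
  s.z2 * (s.q + 1 - s.z1) - s.Z * (s.x2 + s.y1)

def Pt.B (s : Pt) : ℂ :=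
  s.be2 * s.y2 - s.be1

def Pt.ep (s : Pt) : ℂ :=
  s.b * (s.x2 * (s.b - 1) + s.y1 * s.q) + s.c * (s.x2 + s.y1) - (s.y1 * s.z1 + s.z2) * s.d

set_option maxRecDepth 4000 in
set_option maxHeartbeats 2000000 in
theorem Pt.rel1 (s : Pt) : s.U1^2 - s.U1 * s.e + s.a * s.e^2 = s.G * s.Pq := by
  simp only [Pt.q, Pt.d, Pt.e, Pt.Pq, Pt.U1, Pt.G]
  ring

set_option maxRecDepth 4000 in
set_option maxHeartbeats 2000000 in
theorem Pt.rel2 (s : Pt) : s.W1^2 - s.W1 * s.D + s.c * s.D^2 = (-s.W2) * s.W3 := by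
  simp only [Pt.Z, Pt.D, Pt.W2, Pt.W1, Pt.W3]
  ring

set_option maxRecDepth 4000 in
set_option maxHeartbeats 2000000 in
theorem Pt.nrnq (s : Pt) : s.Nr = (s.a - s.c) * s.x2 * s.p2 - s.Nq := by
  simp only [Pt.Z, Pt.X, Pt.q, Pt.d, Pt.e, Pt.Pq, Pt.U1, Pt.G, Pt.Nr, Pt.D, Pt.W2, Pt.W1, Pt.W3, Pt.Nq, Pt.p2]
  ring

set_option maxRecDepth 4000 in
set_option maxHeartbeats 2000000 in
theorem Pt.i1 (s : Pt) : s.D * s.p2 = s.be2 * s.t - s.z2 * s.be1 := by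
  simp only [Pt.Z, Pt.q, Pt.D, Pt.W2, Pt.W1, Pt.t, Pt.be1, Pt.be2, Pt.p2]
  ring

set_option maxRecDepth 4000 in
set_option maxHeartbeats 2000000 in
theorem Pt.i2 (s : Pt) : s.z2 * s.al1 + s.y1 * s.al3 = s.x2 * (s.B + (s.a - s.c) * s.z2) := by
  simp only [Pt.Z, Pt.q, Pt.d, Pt.e, Pt.Pq, Pt.U1, Pt.al1, Pt.al3, Pt.D, Pt.W2, Pt.W1, Pt.be1, Pt.be2, Pt.B]
  ring

set_option maxRecDepth 4000 in
set_option maxHeartbeats 2000000 in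
theorem Pt.i3 (s : Pt) : s.B * s.p2 * s.x2 + s.z2 * s.Nq + s.be2 * s.al3 = 0 := by
  simp only [Pt.Z, Pt.X, Pt.q, Pt.d, Pt.e, Pt.Pq, Pt.al3, Pt.D, Pt.W2, Pt.W1, Pt.W3, Pt.Nq, Pt.be1, Pt.be2, Pt.p2, Pt.B]
  ring

set_option maxRecDepth 4000 in
set_option maxHeartbeats 2000000 in
theorem Pt.i4 (s : Pt) : s.B + (s.a - s.c) * s.z2 + s.al3 + s.d * s.p2 = 0 := by
  simp only [Pt.Z, Pt.q, Pt.d, Pt.e, Pt.Pq, Pt.al3, Pt.D, Pt.W2, Pt.W1, Pt.be1, Pt.be2, Pt.p2, Pt.B]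
  ring

set_option maxRecDepth 4000 in
set_option maxHeartbeats 2000000 in
theorem Pt.i5 (s : Pt) : s.b * (s.x2 + s.y1) * s.e - s.U1 * (s.x2 + s.y1) + s.G =  - s.e * s.d * s.y1 := by
  simp only [Pt.q, Pt.d, Pt.e, Pt.Pq, Pt.U1, Pt.G]
  ring

set_option maxRecDepth 4000 in
set_option maxHeartbeats 2000000 in
theorem Pt.i6 (s : Pt) : s.z2 * ((s.x2 + s.y1) * s.al1 + s.al2) = s.d * s.x2 * (s.y1 * s.p2 + s.be2) := by
  simp only [Pt.Z, Pt.q, Pt.d, Pt.e, Pt.Pq, Pt.U1, Pt.G, Pt.al1, Pt.al2, Pt.D, Pt.W2, Pt.be2, Pt.p2]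
  ring

set_option maxRecDepth 4000 in
set_option maxHeartbeats 2000000 in
theorem Pt.i7 (s : Pt) : (s.b - 1) * s.e + s.U1 - (s.x2 + s.y1) * s.Pq =  - s.e * s.d := by
  simp only [Pt.q, Pt.d, Pt.e, Pt.Pq, Pt.U1]
  ring

set_option maxRecDepth 4000 in
set_option maxHeartbeats 2000000 in
theorem Pt.i8 (s : Pt) : s.V2n + s.Pq = s.e * s.y2 := by
  simp only [Pt.q, Pt.d, Pt.e, Pt.Pq, Pt.V2n]
  ring

set_option maxRecDepth 4000 in
set_option maxHeartbeats 2000000 in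
theorem Pt.i9 (s : Pt) : s.U1 + (s.x2 + s.y1) * s.V2n = s.e * (s.x1 + s.y1 * s.y2) := by
  simp only [Pt.q, Pt.d, Pt.e, Pt.Pq, Pt.V2n, Pt.U1]
  ring

set_option maxRecDepth 4000 in
set_option maxHeartbeats 2000000 in
theorem Pt.j1 (s : Pt) : s.al1 * s.y1 + s.al2 = s.x2 * (-s.ep - (s.a - s.c) * (s.x2 + s.y1)) := by
  simp only [Pt.q, Pt.d, Pt.e, Pt.Pq, Pt.U1, Pt.G, Pt.al1, Pt.al2, Pt.ep]
  ring

set_option maxRecDepth 4000 in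
set_option maxHeartbeats 2000000 in
theorem Pt.j2 (s : Pt) : (s.x2 + s.y1) * s.Nq + s.x2 * s.p2 * s.ep = s.al1 * s.be2 := by
  simp only [Pt.Z, Pt.X, Pt.q, Pt.d, Pt.e, Pt.Pq, Pt.U1, Pt.al1, Pt.D, Pt.W2, Pt.W1, Pt.W3, Pt.Nq, Pt.be2, Pt.p2, Pt.ep]
  ring

set_option maxRecDepth 4000 in
set_option maxHeartbeats 2000000 in
theorem Pt.j3 (s : Pt) : s.t1 * s.p2 + s.b * s.be2 = s.z1 * s.be2 + s.z2 * s.ep := by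
  simp only [Pt.Z, Pt.q, Pt.d, Pt.D, Pt.W2, Pt.t1, Pt.be2, Pt.p2, Pt.ep]
  ring

set_option maxRecDepth 4000 in
set_option maxHeartbeats 2000000 in
theorem Pt.j4 (s : Pt) : s.W2 * s.t - s.z2 * s.W1 =  - s.D * (s.y1 * s.Z + s.z1 * s.z2) := by
  simp only [Pt.Z, Pt.D, Pt.W2, Pt.W1, Pt.t]
  ring

set_option maxRecDepth 4000 in
set_option maxHeartbeats 2000000 in
theorem Pt.j4b (s : Pt) : s.W2 * s.t - s.z2 * s.W1 + (1 - s.b) * s.z2 * s.D =  - s.D^2 := by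
  simp only [Pt.Z, Pt.D, Pt.W2, Pt.W1, Pt.t]
  ring

set_option maxRecDepth 4000 in
set_option maxHeartbeats 2000000 in
theorem Pt.j5 (s : Pt) : s.b * s.W2 - s.t1 * (s.y1 * s.Z + s.z1 * s.z2 - s.z2) = s.D * (s.z1 * s.y1 + s.z2) := by
  simp only [Pt.Z, Pt.D, Pt.W2, Pt.t1]
  ring

set_option maxRecDepth 4000 in
set_option maxHeartbeats 2000000 in
theorem Pt.j6 (s : Pt) : s.W2 + s.t1 * s.z2 = s.D * s.y1 := by
  simp only [Pt.Z, Pt.D, Pt.W2, Pt.t1]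
  ring

set_option maxRecDepth 4000 in
set_option maxHeartbeats 2000000 in
theorem Pt.j7 (s : Pt) : s.t1 * s.t + s.W1 = s.D * (s.z1 + s.y1 * s.y2) := by
  simp only [Pt.Z, Pt.D, Pt.W1, Pt.t1, Pt.t]
  ring

set_option maxRecDepth 4000 in
set_option maxHeartbeats 2000000 in
theorem Pt.k1 (s : Pt) : s.W2 * s.t^2 + (s.D - 2 * s.W1) * s.t * s.z2 - s.W3 * s.z2^2 = s.D^2 * s.Z := by
  simp only [Pt.Z, Pt.D, Pt.W2, Pt.W1, Pt.t, Pt.W3]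
  ring

set_option maxRecDepth 4000 in
set_option maxHeartbeats 2000000 in
theorem Pt.k2 (s : Pt) : s.x2 * s.be2 * s.t^2 - 2 * s.x2 * s.be1 * s.t * s.z2 + s.ka * s.z2^2 =  - s.D * (s.z2 * s.al3 + s.Z * s.x2 * s.p2) := by
  simp only [Pt.Z, Pt.X, Pt.q, Pt.d, Pt.e, Pt.Pq, Pt.al3, Pt.D, Pt.W2, Pt.W1, Pt.t, Pt.W3, Pt.be1, Pt.be2, Pt.ka, Pt.p2]
  ring

/-- Denominator of `R` at a point `((U/e, -G/e), (z₁, z₂))`. -/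
theorem rden_aux (a c e U G P z₁ z₂ : ℂ) (he : e ≠ 0) (rel : U ^ 2 - U * e + a * e ^ 2 = G * P) :
    a * z₂ ^ 2 + c * (-G / e) ^ 2 + (a + c - 1) * z₂ * (-G / e) +
      (-G / e * z₁ - U / e * z₂) * (-G / e * z₁ - U / e * z₂ + z₂ - -G / e) =
    -G * (z₂ * ((a + c + z₁ - 1) * e + (1 - 2 * z₁) * U) - G * (c + z₁ ^ 2 - z₁) - P * z₂ ^ 2)
      / e ^ 2 := by
  field_simp
  linear_combination (z₂ ^ 2) * rel

/-- The map `R` at a point `((U/e, -G/e), (z₁, z₂))`. -/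
theorem rmap_aux (a c e U G P z₁ z₂ : ℂ) (he : e ≠ 0) (rel : U ^ 2 - U * e + a * e ^ 2 = G * P)
    (N : ℂ) (hN : N = z₂ * ((a + c + z₁ - 1) * e + (1 - 2 * z₁) * U) - G * (c + z₁ ^ 2 - z₁)
      - P * z₂ ^ 2) (hG : G ≠ 0) (hN0 : N ≠ 0) :
    rmap a c ((U / e, -G / e), (z₁, z₂)) =
      ((z₁ + z₂ * (a - c) * (U + (z₁ - 1) * e) / N, z₂ + z₂ * (a - c) * (z₂ * e - G) / N),
       (U / e - z₂ * (a - c) * (U + (z₁ - 1) * e) / N,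
        -G / e - z₂ * (a - c) * (z₂ * e - G) / N)) := by
  simp only [rmap]
  rw [rden_aux a c e U G P z₁ z₂ he rel, ← hN]
  refine Prod.ext (Prod.ext ?_ ?_) (Prod.ext ?_ ?_) <;> simp only
  · field_simp
    ring
  · field_simp
    rw [hN]
    linear_combination (-z₂ ^ 3) * rel
  · field_simp
    ring
  · field_simp
    rw [hN]
    linear_combination (z₂ ^ 2) * rel

set_option maxHeartbeats 2000000 in
/-- The second image point of `R` lies on the right quadric. -/
theorem rquad_aux (a c e U G P z₁ z₂ : ℂ) (he : e ≠ 0) (rel : U ^ 2 - U * e + a * e ^ 2 = G * P)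
    (N : ℂ) (hN : N = z₂ * ((a + c + z₁ - 1) * e + (1 - 2 * z₁) * U) - G * (c + z₁ ^ 2 - z₁)
      - P * z₂ ^ 2) (hN0 : N ≠ 0) (w₁ w₂ : ℂ)
    (hw1 : w₁ = U / e - z₂ * (a - c) * (U + (z₁ - 1) * e) / N)
    (hw2 : w₂ = -G / e - z₂ * (a - c) * (z₂ * e - G) / N) :
    c + w₁ ^ 2 - w₁ = w₂ * (-P / e - (a - c) * ((c + z₁ ^ 2 - z₁) * e - z₂ * P) / N) := by
  rw [hw1, hw2]
  field_simp
  rw [hN]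
  linear_combination (a*c*e^2*z₂^2 +a*e^2*z₁^2*z₂^2 -a*e^2*z₁*z₂^2 +3*c^2*e^2*z₂^2 -2*c^2*e*G*z₂
      -c*e^2*z₁^2*z₂^2 +5*c*e^2*z₁*z₂^2 -4*c*e^2*z₂^2 -8*c*e*U*z₁*z₂^2 +4*c*e*U*z₂^2
      -2*c*e*G*z₁^2*z₂ +c*e*G*z₁*z₂ +c*e*G*z₂ -4*c*e*P*z₂^3 +2*c*U*G*z₁*z₂ -c*U*G*z₂ +c*G*P*z₂^2
      +e^2*z₁^2*z₂^2 -2*e^2*z₁*z₂^2 +e^2*z₂^2 -4*e*U*z₁^2*z₂^2 +6*e*U*z₁*z₂^2 -2*e*U*z₂^2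
      -e*G*z₁^3*z₂ +2*e*G*z₁^2*z₂ -e*G*z₁*z₂ -2*e*P*z₁*z₂^3 +2*e*P*z₂^3 +4*U^2*z₁^2*z₂^2
      -4*U^2*z₁*z₂^2 +U^2*z₂^2 +2*U*G*z₁^3*z₂ -3*U*G*z₁^2*z₂ +U*G*z₁*z₂ +4*U*P*z₁*z₂^3
      -2*U*P*z₂^3 +G*P*z₁^2*z₂^2 -G*P*z₁*z₂^2 +P^2*z₂^4 + (c + z₁ ^ 2 - z₁) *
      (-G * (z₂ * ((a + c + z₁ - 1) * e + (1 - 2 * z₁) * U) - G * (c + z₁ ^ 2 - z₁)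
      - P * z₂ ^ 2) - (a - c) * (z₂ * e - G) * z₂ * e)) * rel

/-- `R` is symmetric under swapping its two arguments together with the parameters. -/
theorem rmap_swap (a c : ℂ) (x y : ℂ × ℂ) :
    rmap a c (x, y) = ((rmap c a (y, x)).2, (rmap c a (y, x)).1) := by
  obtain ⟨x₁, x₂⟩ := x
  obtain ⟨y₁, y₂⟩ := y
  simp only [rmap]
  have h : c * x₂ ^ 2 + a * y₂ ^ 2 + (c + a - 1) * x₂ * y₂ +
    (y₂ * x₁ - y₁ * x₂) * (y₂ * x₁ - y₁ * x₂ + x₂ - y₂) =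
    a * y₂ ^ 2 + c * x₂ ^ 2 + (a + c - 1) * y₂ * x₂ +
    (x₂ * y₁ - x₁ * y₂) * (x₂ * y₁ - x₁ * y₂ + y₂ - x₂) := by ring
  rw [h]
  refine Prod.ext (Prod.ext ?_ ?_) (Prod.ext ?_ ?_) <;> simp only <;> ring

theorem rDom_swap (a c : ℂ) (x y : ℂ × ℂ) (h : rDom a c (x, y)) : rDom c a (y, x) := by
  simp only [rDom] at h ⊢
  intro h0
  apply h
  rw [← h0]
  ring

/-- `T` in terms of the quadric parameter `k` of the second argument. -/
theorem tmap_aux (a b x₁ x₂ y₁ y₂ k m : ℂ) (hk : b + y₁ ^ 2 - y₁ = y₂ * k)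
    (hm : m = x₁ * k + a + y₁ - 1) (hy : y₂ ≠ 0) (hm0 : m ≠ 0) :
    tmap a b ((x₁, x₂), (y₁, y₂)) =
      (((a * x₁ - y₁ * x₁ - y₂) / m, x₂ - k),
       (y₁ + x₁ * x₂ - (a * x₁ - y₁ * x₁ - y₂) / m * (x₂ - k),
        x₁ - (a * x₁ - y₁ * x₁ - y₂) / m)) := by
  simp only [tmap]
  have hb : b = y₂ * k + y₁ - y₁ ^ 2 := by linear_combination hk
  have hD : b * x₁ + (y₁ - 1) * y₁ * x₁ + (a + y₁ - 1) * y₂ = y₂ * m := by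
    rw [hm, hb]; ring
  rw [hD]
  refine Prod.ext (Prod.ext ?_ ?_) (Prod.ext ?_ ?_) <;> simp only
  · field_simp
  · field_simp
    rw [hb]; ring
  · field_simp
    rw [hm, hb]; ring
  · field_simp

theorem tDom_aux (a b x₁ x₂ y₁ y₂ k m : ℂ) (hk : b + y₁ ^ 2 - y₁ = y₂ * k)
    (hm : m = x₁ * k + a + y₁ - 1) (h : tDom a b ((x₁, x₂), (y₁, y₂))) : y₂ ≠ 0 ∧ m ≠ 0 := by
  obtain ⟨h1, h2⟩ := h
  simp only at h1 h2
  refine ⟨h1, ?_⟩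
  rintro rfl
  apply h2
  linear_combination x₁ * hk - y₂ * hm

/-- `S` in terms of the quadric parameter `k` of the first argument. -/
theorem smap_aux (a b x₁ x₂ y₁ y₂ k d v : ℂ) (hk : a + x₁ ^ 2 - x₁ = x₂ * k)
    (hd : d = x₂ * y₂ - x₁ - b + 1) (hx : x₂ ≠ 0) (hd0 : d ≠ 0)
    (hv : v = y₂ - (x₂ * y₂ ^ 2 + (1 - 2 * x₁) * y₂ + k) / d) :
    smap a b ((x₁, x₂), (y₁, y₂)) =
      ((y₁ * y₂ + x₁ - (x₂ + y₁) * v,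
        (y₁ * y₂ + b) * x₂ + y₁ * (1 - x₁) - (y₁ * y₂ + x₁ - (x₂ + y₁) * v) * (x₂ + y₁)),
       (x₂ + y₁, v)) := by
  simp only [smap]
  have ha : a = x₂ * k + x₁ - x₁ ^ 2 := by linear_combination hk
  rw [← hd, hv]
  refine Prod.ext (Prod.ext ?_ ?_) (Prod.ext ?_ ?_) <;> simp only
  · field_simp
    rw [ha, hd]; ring
  · field_simp
    rw [ha, hd]; ring
  · field_simp
    rw [ha, hd]; ring

theorem Pt.smap_eq (s : Pt) (hx : s.x2 ≠ 0) (hd : s.d ≠ 0) :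
    smap s.a s.b ((s.x1, s.x2), (s.y1, s.y2)) =
      ((s.U1 / s.e, -s.G / s.e), (s.x2 + s.y1, s.V2n / s.e)) := by
  have h : s.x2 * s.y2 - s.x1 - s.b + 1 = s.d := by simp only [Pt.d, Pt.q]
  simp only [smap]
  rw [h]
  simp only [Pt.e]
  refine Prod.ext (Prod.ext ?_ ?_) (Prod.ext ?_ ?_) <;> simp only
  · field_simp
    simp only [Pt.U1, Pt.Pq, Pt.d, Pt.q]; ring
  · congr 1
    simp only [Pt.G, Pt.q]; ring
  · field_simp
    simp only [Pt.V2n, Pt.d, Pt.q]; ring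

theorem Pt.tmap_eq (s : Pt) (hz : s.z2 ≠ 0) (hD : s.D ≠ 0) :
    tmap s.b s.c ((s.y1, s.y2), (s.z1, s.z2)) =
      ((s.t1 * s.z2 / s.D, s.t / s.z2), (s.W1 / s.D, - (-s.W2) / s.D)) := by
  have h : s.c * s.y1 + (s.z1 - 1) * s.z1 * s.y1 + (s.b + s.z1 - 1) * s.z2 = s.D := by
    simp only [Pt.D, Pt.Z]; ring
  simp only [tmap]
  rw [h]
  refine Prod.ext (Prod.ext ?_ ?_) (Prod.ext ?_ ?_) <;> simp only
  · simp only [Pt.t1]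
  · field_simp
    simp only [Pt.t, Pt.Z]; ring
  · congr 1
    simp only [Pt.W1, Pt.Z]; ring
  · have h6 := s.j6
    field_simp
    have ht : s.t1 = s.b * s.y1 - s.z1 * s.y1 - s.z2 := rfl
    linear_combination -h6 + s.z2 * ht

set_option maxHeartbeats 2000000 in
/-- The entwining Yang–Baxter equation in coordinates. -/
theorem Pt.main (s : Pt)
    (h1 : sDom s.b ((s.x1, s.x2), (s.y1, s.y2)))
    (h2 : rDom s.a s.c ((smap s.a s.b ((s.x1, s.x2), (s.y1, s.y2))).1, (s.z1, s.z2)))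
    (h3 : tDom s.b s.c ((smap s.a s.b ((s.x1, s.x2), (s.y1, s.y2))).2,
      (rmap s.a s.c ((smap s.a s.b ((s.x1, s.x2), (s.y1, s.y2))).1, (s.z1, s.z2))).2))
    (h4 : tDom s.b s.c ((s.y1, s.y2), (s.z1, s.z2)))
    (h5 : rDom s.a s.c ((s.x1, s.x2), (tmap s.b s.c ((s.y1, s.y2), (s.z1, s.z2))).2))
    (h6 : sDom s.b ((rmap s.a s.c ((s.x1, s.x2),
        (tmap s.b s.c ((s.y1, s.y2), (s.z1, s.z2))).2)).1,
      (tmap s.b s.c ((s.y1, s.y2), (s.z1, s.z2))).1)) :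
    ((rmap s.a s.c ((smap s.a s.b ((s.x1, s.x2), (s.y1, s.y2))).1, (s.z1, s.z2))).1,
      tmap s.b s.c ((smap s.a s.b ((s.x1, s.x2), (s.y1, s.y2))).2,
        (rmap s.a s.c ((smap s.a s.b ((s.x1, s.x2), (s.y1, s.y2))).1, (s.z1, s.z2))).2)) =
    ((smap s.a s.b ((rmap s.a s.c ((s.x1, s.x2),
        (tmap s.b s.c ((s.y1, s.y2), (s.z1, s.z2))).2)).1,
        (tmap s.b s.c ((s.y1, s.y2), (s.z1, s.z2))).1)).1,
      (smap s.a s.b ((rmap s.a s.c ((s.x1, s.x2),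
        (tmap s.b s.c ((s.y1, s.y2), (s.z1, s.z2))).2)).1,
        (tmap s.b s.c ((s.y1, s.y2), (s.z1, s.z2))).1)).2,
      (rmap s.a s.c ((s.x1, s.x2),
        (tmap s.b s.c ((s.y1, s.y2), (s.z1, s.z2))).2)).2) := by
  obtain ⟨hx, hd⟩ := h1
  obtain ⟨hz, hD⟩ := h4
  simp only at hx hd hz hD
  replace hd : s.d ≠ 0 := by simpa only [Pt.d, Pt.q] using hd
  replace hD : s.D ≠ 0 := by
    intro h0
    apply hD
    rw [← h0]
    simp only [Pt.D, Pt.Z]; ring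
  have he : s.e ≠ 0 := mul_ne_zero hx hd
  rw [s.smap_eq hx hd] at h2 h3 ⊢
  rw [s.tmap_eq hz hD] at h5 h6 ⊢
  simp only at h2 h3 h5 h6 ⊢
  -- the first application of `R`
  have hNr : s.Nr = s.z2 * ((s.a + s.c + s.z1 - 1) * s.e + (1 - 2 * s.z1) * s.U1)
      - s.G * (s.c + s.z1 ^ 2 - s.z1) - s.Pq * s.z2 ^ 2 := by simp only [Pt.Nr, Pt.Z]
  have hNq : s.Nq = s.x2 * ((s.c + s.a + s.x1 - 1) * s.D + (1 - 2 * s.x1) * s.W1)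
      - -s.W2 * (s.a + s.x1 ^ 2 - s.x1) - s.W3 * s.x2 ^ 2 := by simp only [Pt.Nq, Pt.X]; ring
  have hNG : s.G ≠ 0 ∧ s.Nr ≠ 0 := by
    simp only [rDom] at h2
    rw [rden_aux s.a s.c s.e s.U1 s.G s.Pq s.z1 s.z2 he s.rel1, ← hNr] at h2
    constructor <;> intro h0 <;> apply h2 <;> rw [h0] <;> simp
  obtain ⟨hG, hNr0⟩ := hNG
  have hNW : -s.W2 ≠ 0 ∧ s.Nq ≠ 0 := by
    have h5' := rDom_swap _ _ _ _ h5
    simp only [rDom] at h5'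
    rw [rden_aux s.c s.a s.D s.W1 (-s.W2) s.W3 s.x1 s.x2 hD s.rel2, ← hNq] at h5'
    constructor <;> intro h0 <;> apply h5' <;> rw [h0] <;> simp
  obtain ⟨hW, hNq0⟩ := hNW
  rw [rmap_aux s.a s.c s.e s.U1 s.G s.Pq s.z1 s.z2 he s.rel1 s.Nr hNr hG hNr0] at h3 ⊢
  rw [rmap_swap, rmap_aux s.c s.a s.D s.W1 (-s.W2) s.W3 s.x1 s.x2 hD s.rel2 s.Nq hNq hW hNq0]
    at h6 ⊢
  simp only at h3 h6 ⊢
  have hk1 := rquad_aux s.a s.c s.e s.U1 s.G s.Pq s.z1 s.z2 he s.rel1 s.Nr hNr hNr0 _ _ rfl rfl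
  have hk2 := rquad_aux s.c s.a s.D s.W1 (-s.W2) s.W3 s.x1 s.x2 hD s.rel2 s.Nq hNq hNq0 _ _ rfl rfl
  rw [show s.U1 + (s.z1 - 1) * s.e = s.al1 from rfl, show s.z2 * s.e - s.G = s.al2 from rfl]
    at h3 hk1 ⊢
  rw [show s.W1 + (s.x1 - 1) * s.D = s.be1 from rfl,
    show s.x2 * s.D - -s.W2 = s.be2 by simp only [Pt.be2]; ring] at h6 hk2 ⊢
  rw [show (s.c + s.z1 ^ 2 - s.z1) * s.e - s.z2 * s.Pq = s.al3 from rfl] at hk1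
  rw [show (s.a + s.x1 ^ 2 - s.x1) * s.D - s.x2 * s.W3 = s.ka from rfl] at hk2
  -- the last `T` on the left-hand side
  have i2 := s.i2
  have i3 := s.i3
  have i4 := s.i4
  have i5 := s.i5
  have i6 := s.i6
  have i7 := s.i7
  have i8 := s.i8
  have i9 := s.i9
  have nrnq := s.nrnq
  have hNrNq : (s.a - s.c) * s.x2 * s.p2 = s.Nr + s.Nq := by linear_combination -nrnq
  have hee : s.e = s.x2 * s.d := rfl
  have hm1 : s.d * s.Nq / s.Nr = (s.x2 + s.y1) * (-s.Pq / s.e - (s.a - s.c) * s.al3 / s.Nr) + s.b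
      + (s.U1 / s.e - s.z2 * (s.a - s.c) * s.al1 / s.Nr) - 1 := by
    field_simp
    linear_combination -s.Nr * i7 + (s.a - s.c) * s.e * i2 + (s.a - s.c) * s.e * s.x2 * i4
      - s.e * s.d * hNrNq
  obtain ⟨hw0, hm0⟩ := tDom_aux _ _ _ _ _ _ _ _ hk1 hm1 h3
  rw [tmap_aux _ _ _ _ _ _ _ _ hk1 hm1 hw0 hm0]
  have hv1 : (s.b * (s.x2 + s.y1) - (s.U1 / s.e - s.z2 * (s.a - s.c) * s.al1 / s.Nr) *
      (s.x2 + s.y1) - (-s.G / s.e - s.z2 * (s.a - s.c) * s.al2 / s.Nr)) / (s.d * s.Nq / s.Nr) =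
      s.y1 + (s.a - s.c) * s.x2 * s.be2 / s.Nq := by
    field_simp
    linear_combination s.Nr * i5 + (s.a - s.c) * s.e * i6 + s.e * s.d * s.y1 * hNrNq
  have hv2 : s.V2n / s.e - (-s.Pq / s.e - (s.a - s.c) * s.al3 / s.Nr) =
      s.y2 + (s.a - s.c) * s.al3 / s.Nr := by
    field_simp
    linear_combination s.Nr * i8
  rw [hv1, hv2]
  -- the last `S` on the right-hand side
  obtain ⟨hu0, hds⟩ := h6
  simp only at hu0 hds
  have hu2 : - -s.W2 / s.D - s.x2 * (s.c - s.a) * s.be2 / s.Nq + s.t1 * s.z2 / s.D =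
      s.y1 + (s.a - s.c) * s.x2 * s.be2 / s.Nq := by
    have := s.j6
    field_simp
    linear_combination s.Nq * this
  have hdd : s.D * s.Nr / (s.Nq * s.z2) =
      (- -s.W2 / s.D - s.x2 * (s.c - s.a) * s.be2 / s.Nq) * (s.t / s.z2) -
      (s.W1 / s.D - s.x2 * (s.c - s.a) * s.be1 / s.Nq) - s.b + 1 := by
    have j4b := s.j4b
    have i1 := s.i1
    field_simp
    linear_combination -s.Nq * j4b + (s.a - s.c) * s.x2 * s.D * i1 - s.D ^ 2 * hNrNq
  have hvv : s.y2 + (s.a - s.c) * s.al3 / s.Nr = s.t / s.z2 -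
      ((- -s.W2 / s.D - s.x2 * (s.c - s.a) * s.be2 / s.Nq) * (s.t / s.z2) ^ 2 +
      (1 - 2 * (s.W1 / s.D - s.x2 * (s.c - s.a) * s.be1 / s.Nq)) * (s.t / s.z2) +
      (-s.W3 / s.D - (s.c - s.a) * s.ka / s.Nq)) / (s.D * s.Nr / (s.Nq * s.z2)) := by
    have k1 := s.k1
    have k2 := s.k2
    have ht : s.t = s.y2 * s.z2 - s.Z := rfl
    field_simp
    linear_combination s.Nq * k1 + (s.a - s.c) * s.D * k2 - s.D ^ 2 * s.Z * hNrNq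
      - s.Nr * s.D ^ 2 * ht
  rw [smap_aux _ _ _ _ _ _ _ _ _ hk2 hdd hu0 (by rw [hdd]; exact hds) hvv, hu2]
  have hB : s.be2 * s.y2 - s.be1 = s.B := rfl
  have hI : s.Nq * (s.z2 * s.al1 + s.y1 * s.al3) + s.x2 * (s.be2 * s.y2 - s.be1) * s.Nr +
      (s.a - s.c) * s.x2 * s.be2 * s.al3 = 0 := by
    linear_combination s.Nq * i2 + (s.a - s.c) * s.x2 * i3 - s.x2 * s.B * hNrNq
      + s.x2 * s.Nr * hB
  have hJ : s.x2 * s.ep * s.Nr - s.Nq * (s.al1 * s.y1 + s.al2) -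
      (s.a - s.c) * s.x2 * s.al1 * s.be2 = 0 := by
    linear_combination -s.Nq * s.j1 + (s.a - s.c) * s.x2 * s.j2 - s.x2 * s.ep * hNrNq
  have hg1 : s.t1 * s.z2 / s.D * (s.t / s.z2) +
      (s.W1 / s.D - s.x2 * (s.c - s.a) * s.be1 / s.Nq) -
      (s.y1 + (s.a - s.c) * s.x2 * s.be2 / s.Nq) * (s.y2 + (s.a - s.c) * s.al3 / s.Nr) =
      s.z1 + s.z2 * (s.a - s.c) * s.al1 / s.Nr := by
    have j7 := s.j7
    field_simp
    linear_combination s.Nr * s.Nq * j7 - s.D * (s.a - s.c) * hI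
  have hg2 : (s.t1 * s.z2 / s.D * (s.t / s.z2) + s.b) *
      (- -s.W2 / s.D - s.x2 * (s.c - s.a) * s.be2 / s.Nq) +
      s.t1 * s.z2 / s.D * (1 - (s.W1 / s.D - s.x2 * (s.c - s.a) * s.be1 / s.Nq)) =
      s.z1 * s.y1 + s.z2 + (s.a - s.c) * s.x2 * (s.z1 * s.be2 + s.z2 * s.ep) / s.Nq := by
    have i1 := s.i1
    have j3 := s.j3
    have j4 := s.j4
    have j5 := s.j5
    field_simp
    linear_combination s.Nq * (s.t1 * j4 + s.D * j5) +
      (s.a - s.c) * s.x2 * s.D * (-s.t1 * i1 + s.D * j3)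
  rw [hg1, hg2]
  refine Prod.ext (Prod.ext ?_ ?_) (Prod.ext (Prod.ext ?_ ?_) (Prod.ext ?_ ?_)) <;> simp only
  · field_simp
    linear_combination (-(s.a - s.c) * s.z2) * hJ
  · field_simp
    linear_combination s.Nr * s.Nq * i9 - s.e * (s.a - s.c) * hI
  · ring

/-- The maps `S`, `R`, `T` with strong Lax triple `(L₁,L₂,L₁)` satisfy the
entwining Yang–Baxter equation on the (Zariski-open) domain of definition of
both compositions. -/
theorem stmt19 (a b c : ℂ) (p : (ℂ × ℂ) × (ℂ × ℂ) × (ℂ × ℂ))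
    (h1 : sDom b (p.1, p.2.1))
    (h2 : rDom a c ((act12 (smap a b) p).1, (act12 (smap a b) p).2.2))
    (h3 : tDom b c ((act13 (rmap a c) (act12 (smap a b) p)).2.1,
                    (act13 (rmap a c) (act12 (smap a b) p)).2.2))
    (h4 : tDom b c (p.2.1, p.2.2))
    (h5 : rDom a c ((act23 (tmap b c) p).1, (act23 (tmap b c) p).2.2))
    (h6 : sDom b ((act13 (rmap a c) (act23 (tmap b c) p)).1,
                  (act13 (rmap a c) (act23 (tmap b c) p)).2.1)) :
    act23 (tmap b c) (act13 (rmap a c) (act12 (smap a b) p)) =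
      act12 (smap a b) (act13 (rmap a c) (act23 (tmap b c) p)) := by
  obtain ⟨⟨x1, x2⟩, ⟨y1, y2⟩, ⟨z1, z2⟩⟩ := p
  simp only [act12, act13, act23] at h1 h2 h3 h4 h5 h6 ⊢
  exact Pt.main ⟨a, b, c, x1, x2, y1, y2, z1, z2⟩ h1 h2 h3 h4 h5 h6

end
end
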